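/- Let T be a non-basic regular Morse tile of dimension n and order k, with restriction set R and Morse face μ with R ⊊ μ, and let l = dim(μ) ≥ k. Then there exists a sequence of 2^{l−k} successive stellar subdivisions, each performed at a facet of the current relative simplicial complex, starting from T, after which the resulting relative simplicial complex carries a shellable h-tiling. Moreover, this h-tiling uses exactly 2^{l+1−k} critical tiles, all of indices in {k, k+1, …, l+1}, and exactly one of its critical tiles has index k and exactly one has index l+1. -/

import Mathlib

open Finset

variable {V : Type*} [DecidableEq V]

/-- A finite simplicial complex: a finite collection of finite sets of vertices
closed under taking subsets. -/
def IsComplex (K : Finset (Finset V)) : Prop :=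
  ∀ σ ∈ K, ∀ τ ⊆ σ, τ ∈ K

/-- The set of nonempty faces of the relative simplicial complex `K ∖ L`. -/
def relFaces (K L : Finset (Finset V)) : Finset (Finset V) :=
  (K \ L).filter (fun τ => τ ≠ ∅)

/-- A set `A` of faces is closed in `S`: every nonempty face of `S` contained in a
member of `A` belongs to `A`. -/
def closedIn (S A : Finset (Finset V)) : Prop :=
  ∀ τ ∈ S, τ ≠ ∅ → ∀ α ∈ A, τ ⊆ α → τ ∈ A

/-- A facet: a maximal face. -/
def IsFacetOf (K : Finset (Finset V)) (θ : Finset V) : Prop :=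
  θ ∈ K ∧ ∀ σ ∈ K, θ ⊆ σ → σ = θ

instance (K : Finset (Finset V)) (θ : Finset V) : Decidable (IsFacetOf K θ) :=
  inferInstanceAs (Decidable (θ ∈ K ∧ ∀ σ ∈ K, θ ⊆ σ → σ = θ))

/-- A ridge: a face of codimension one in every facet containing it. -/
def IsRidgeOf (K : Finset (Finset V)) (θ : Finset V) : Prop :=
  θ ∈ K ∧ ∀ σ, IsFacetOf K σ → θ ⊆ σ → σ.card = θ.card + 1

/-- Stellar subdivision of `K` at the face `θ`, using the new vertex `v`. -/
def stellar (K : Finset (Finset V)) (θ : Finset V) (v : V) : Finset (Finset V) :=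
  K.filter (fun σ => ¬ θ ⊆ σ) ∪
    (K.filter (fun ρ => ¬ θ ⊆ ρ ∧ ρ ∪ θ ∈ K)).image (fun ρ => insert v ρ)

/-- Barycentric subdivision: faces are the chains of nonempty faces of `K`. -/
def barySd (K : Finset (Finset V)) : Finset (Finset (Finset V)) :=
  K.powerset.filter (fun c => ∅ ∉ c ∧ ∀ τ ∈ c, ∀ τ' ∈ c, τ ⊆ τ' ∨ τ' ⊆ τ)

/-- A Morse tile: a simplex `simplex` deprived of the ridges not containing `res`,
together possibly with a Morse face `morse` of higher codimension. -/
structure MorseTile (V : Type*) where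
  simplex : Finset V
  res : Finset V
  morse : Option (Finset V)
  simplex_nonempty : simplex.Nonempty
  res_sub : res ⊆ simplex
  morse_res : ∀ μ ∈ morse, res ⊆ μ
  morse_ssub : ∀ μ ∈ morse, μ ⊂ simplex
  morse_card : ∀ μ ∈ morse, μ.card + 2 ≤ simplex.card

namespace MorseTile

/-- The face set of a Morse tile. -/
def faceSet (T : MorseTile V) : Finset (Finset V) :=
  match T.morse with
  | none => T.simplex.powerset.filter (fun τ => T.res ⊆ τ ∧ τ ≠ ∅)
  | some μ => T.simplex.powerset.filter (fun τ => T.res ⊆ τ ∧ ¬ τ ⊆ μ)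

/-- The dimension of a Morse tile. -/
def dim (T : MorseTile V) : ℕ := T.simplex.card - 1

/-- The order of a Morse tile. -/
def order (T : MorseTile V) : ℕ := T.res.card

/-- The index of a (critical) Morse tile. -/
def index (T : MorseTile V) : ℕ :=
  if T.res = T.simplex then T.simplex.card - 1 else T.res.card

/-- Basic tiles: no Morse face. -/
def IsBasic (T : MorseTile V) : Prop := T.morse = none

/-- Critical tiles: the Morse face equals the restriction set, or the open simplex. -/
def IsCritical (T : MorseTile V) : Prop := T.morse = some T.res ∨ T.res = T.simplex

/-- Tiles allowed in an h-tiling: basic or critical tiles. -/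
def IsHTile (T : MorseTile V) : Prop := T.morse = none ∨ T.morse = some T.res

/-- The closed simplex. -/
def IsClosedSimplex (T : MorseTile V) : Prop := T.morse = none ∧ T.res = ∅

/-- The open simplex. -/
def IsOpenSimplex (T : MorseTile V) : Prop := T.morse = none ∧ T.res = T.simplex

instance (T : MorseTile V) : Decidable T.IsCritical :=
  inferInstanceAs (Decidable (T.morse = some T.res ∨ T.res = T.simplex))

/-- Isomorphism of Morse tiles: a bijection between the underlying simplices mapping
the face set of one onto the face set of the other. -/
def Isom (T T' : MorseTile V) : Prop :=
  ∃ e : V → V, Set.InjOn e (T.simplex : Set V) ∧ T.simplex.image e = T'.simplex ∧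
    T.faceSet.image (fun τ => τ.image e) = T'.faceSet

/-- The subcomplex `L_T` of removed faces of a Morse tile. -/
def removed (T : MorseTile V) : Finset (Finset V) :=
  T.simplex.powerset.filter (fun τ => τ ∉ T.faceSet)

/-- The stellar subdivision of a Morse tile at a face `θ` of its underlying simplex,
as a relative simplicial complex. -/
def stellarSub (T : MorseTile V) (θ : Finset V) (v : V) : Finset (Finset V) :=
  relFaces (stellar T.simplex.powerset θ v) (stellar T.removed θ v)

end MorseTile

/-- The union of the face sets of a list of Morse tiles. -/
def faceUnion (ts : List (MorseTile V)) : Finset (Finset V) :=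
  ts.foldr (fun T A => T.faceSet ∪ A) ∅

/-- A Morse tiling of the set `S` of nonempty faces of a relative complex:
the face sets of the tiles partition `S`, and for every `d` the union of the
face sets of the tiles of dimension at least `d` is closed in `S`. -/
def IsMorseTiling (S : Finset (Finset V)) (ts : List (MorseTile V)) : Prop :=
  ts.Pairwise (fun T T' => Disjoint T.faceSet T'.faceSet) ∧
  faceUnion ts = S ∧
  ∀ d : ℕ, closedIn S (faceUnion (ts.filter (fun T => decide (d ≤ T.dim))))

/-- A Morse shelling: a Morse tiling whose order makes every initial union closed. -/
def IsMorseShelling (S : Finset (Finset V)) (ts : List (MorseTile V)) : Prop :=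
  IsMorseTiling S ts ∧ ∀ p : ℕ, closedIn S (faceUnion (ts.take p))

/-- An h-tiling: a Morse tiling all of whose tiles are basic or critical. -/
def IsHTiling (S : Finset (Finset V)) (ts : List (MorseTile V)) : Prop :=
  IsMorseTiling S ts ∧ ∀ T ∈ ts, T.IsHTile

/-- A shellable (shelled) h-tiling. -/
def IsHShelling (S : Finset (Finset V)) (ts : List (MorseTile V)) : Prop :=
  IsMorseShelling S ts ∧ ∀ T ∈ ts, T.IsHTile

/-- The number of critical tiles of index `k`. -/
def criticalCount (ts : List (MorseTile V)) (k : ℕ) : ℕ :=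
  ts.countP (fun T => decide (T.IsCritical ∧ T.index = k))

/-- The total number of critical tiles. -/
def totalCritical (ts : List (MorseTile V)) : ℕ :=
  ts.countP (fun T => decide T.IsCritical)

/-- The number of tiles of order `k`. -/
def hCount (ts : List (MorseTile V)) (k : ℕ) : ℕ :=
  ts.countP (fun T => decide (T.order = k))

/-- The number of `k`-dimensional faces. -/
def fCount (S : Finset (Finset V)) (k : ℕ) : ℕ :=
  (S.filter (fun τ => τ.card = k + 1)).card

/-- The Euler characteristic of a set of nonempty faces. -/
def eulerChar (S : Finset (Finset V)) : ℤ :=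
  ∑ τ ∈ S, (-1 : ℤ) ^ (τ.card - 1)

/-- A pure `n`-dimensional complex: it has an `n`-dimensional face and all its
facets have dimension `n`. -/
def IsPureDim (n : ℕ) (K : Finset (Finset V)) : Prop :=
  (∃ σ ∈ K, σ.card = n + 1) ∧ ∀ θ, IsFacetOf K θ → θ.card = n + 1

/-- A closed `n`-dimensional pseudo-manifold: a pure `n`-dimensional complex in
which every `(n-1)`-dimensional face is contained in exactly two facets. -/
def IsPseudoManifold (n : ℕ) (K : Finset (Finset V)) : Prop :=
  IsComplex K ∧ IsPureDim n K ∧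
  ∀ ρ ∈ K, ρ.card = n → (K.filter (fun σ => IsFacetOf K σ ∧ ρ ⊆ σ)).card = 2

/-- Strong connectedness: any two facets are joined by a sequence of facets in which
consecutive ones share an `(n-1)`-dimensional face. -/
def StronglyConnected (n : ℕ) (K : Finset (Finset V)) : Prop :=
  ∀ σ σ', IsFacetOf K σ → IsFacetOf K σ' →
    ∃ (m : ℕ) (c : ℕ → Finset V), c 0 = σ ∧ c m = σ' ∧
      (∀ i ≤ m, IsFacetOf K (c i)) ∧
      ∀ i < m, ∃ ρ : Finset V, ρ.card = n ∧ ρ ⊆ c i ∧ ρ ⊆ c (i + 1)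

/-- Classical shellability of a finite simplicial complex. -/
def ClassicallyShellable (K : Finset (Finset V)) : Prop :=
  ∃ (N : ℕ) (f : Fin N → Finset V), Function.Injective f ∧
    (∀ σ, IsFacetOf K σ ↔ ∃ i, f i = σ) ∧
    ∀ p : Fin N, 0 < (p : ℕ) →
      ∃ R : Finset V, R ≠ ∅ ∧ R ⊆ f p ∧
        ∀ τ : Finset V,
          ((τ ≠ ∅ ∧ τ ⊆ f p ∧ ∀ q, q < p → ¬ τ ⊆ f q) ↔ (R ⊆ τ ∧ τ ⊆ f p))

/-! ### Faces of tiles and stellar subdivisions at facets -/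

namespace MorseTile

theorem mem_faceSet_of_none {T : MorseTile V} (h : T.morse = none) {τ : Finset V} :
    τ ∈ T.faceSet ↔ τ ⊆ T.simplex ∧ T.res ⊆ τ ∧ τ ≠ ∅ := by
  simp [faceSet, h]

theorem mem_faceSet_of_some {T : MorseTile V} {μ : Finset V} (h : T.morse = some μ)
    {τ : Finset V} : τ ∈ T.faceSet ↔ τ ⊆ T.simplex ∧ T.res ⊆ τ ∧ ¬ τ ⊆ μ := by
  simp [faceSet, h]

theorem simplex_mem_faceSet (T : MorseTile V) : T.simplex ∈ T.faceSet := by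
  rcases h : T.morse with _ | μ
  · exact (mem_faceSet_of_none h).2
      ⟨Subset.rfl, T.res_sub, T.simplex_nonempty.ne_empty⟩
  · exact (mem_faceSet_of_some h).2 ⟨Subset.rfl, T.res_sub, (T.morse_ssub μ h).2⟩

theorem subset_simplex {T : MorseTile V} {τ : Finset V} (h : τ ∈ T.faceSet) :
    τ ⊆ T.simplex := by
  rcases h' : T.morse with _ | μ
  · exact ((mem_faceSet_of_none h').1 h).1
  · exact ((mem_faceSet_of_some h').1 h).1

theorem ne_empty_of_mem_faceSet {T : MorseTile V} {τ : Finset V} (h : τ ∈ T.faceSet) :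
    τ ≠ ∅ := by
  rcases h' : T.morse with _ | μ
  · exact ((mem_faceSet_of_none h').1 h).2.2
  · rintro rfl
    exact ((mem_faceSet_of_some h').1 h).2.2 (empty_subset _)

end MorseTile

theorem mem_faceUnion {ts : List (MorseTile V)} {τ : Finset V} :
    τ ∈ faceUnion ts ↔ ∃ T ∈ ts, τ ∈ T.faceSet := by
  induction ts with
  | nil => simp [faceUnion]
  | cons T ts ih =>
    have h : faceUnion (T :: ts) = T.faceSet ∪ faceUnion ts := rfl
    simp [h, ih]

theorem mem_stellar_of_isFacetOf {K : Finset (Finset V)} {θ τ : Finset V} {v : V}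
    (hK : IsComplex K) (hθ : IsFacetOf K θ) :
    τ ∈ stellar K θ v ↔ (τ ∈ K ∧ τ ≠ θ) ∨ ∃ ρ, ρ ⊂ θ ∧ τ = insert v ρ := by
  simp only [stellar, mem_union, mem_filter, mem_image]
  constructor
  · rintro (⟨h, h'⟩ | ⟨ρ, ⟨-, h', h''⟩, rfl⟩)
    · exact .inl ⟨h, fun e => h' (e ▸ Subset.rfl)⟩
    · have := hθ.2 _ h'' subset_union_right
      exact .inr ⟨ρ, ⟨by rw [← this]; exact subset_union_left, h'⟩, rfl⟩
  · rintro (⟨h, h'⟩ | ⟨ρ, h, rfl⟩)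
    · exact .inl ⟨h, fun e => h' (hθ.2 _ h e)⟩
    · exact .inr ⟨ρ, ⟨hK _ hθ.1 _ h.1, h.2, by rw [union_eq_right.2 h.1]; exact hθ.1⟩, rfl⟩

theorem stellar_of_notMem {L : Finset (Finset V)} {θ : Finset V} {v : V}
    (hL : IsComplex L) (hθ : θ ∉ L) : stellar L θ v = L := by
  ext τ
  simp only [stellar, mem_union, mem_filter, mem_image]
  constructor
  · rintro (⟨h, -⟩ | ⟨ρ, ⟨-, -, h⟩, -⟩)
    · exact h
    · exact absurd (hL _ h _ subset_union_right) hθ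
  · exact fun h => .inl ⟨h, fun h' => hθ (hL _ h _ h')⟩

theorem IsComplex.stellar {K : Finset (Finset V)} {θ : Finset V} {v : V}
    (hK : IsComplex K) (hθ : IsFacetOf K θ) : IsComplex (stellar K θ v) := by
  intro σ hσ τ hτ
  rw [mem_stellar_of_isFacetOf hK hθ] at hσ ⊢
  rcases hσ with ⟨h, h'⟩ | ⟨ρ, h, rfl⟩
  · exact .inl ⟨hK _ h _ hτ, fun e => h' (hθ.2 _ h (e ▸ hτ))⟩
  · have h1 : τ.erase v ⊆ ρ := by grind
    have h2 : τ.erase v ⊂ θ := h1.trans_ssubset h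
    by_cases hv : v ∈ τ
    · exact .inr ⟨_, h2, (insert_erase hv).symm⟩
    · rw [erase_eq_of_notMem hv] at h2
      exact .inl ⟨hK _ hθ.1 _ h2.1, h2.ne⟩

theorem IsFacetOf.relFaces {K L : Finset (Finset V)} {θ : Finset V} (h : IsFacetOf K θ)
    (hL : θ ∉ L) (hne : θ.Nonempty) : IsFacetOf (relFaces K L) θ := by
  refine ⟨?_, fun σ hσ => h.2 σ ?_⟩
  · simp [_root_.relFaces, h.1, hL, hne.ne_empty]
  · simp only [_root_.relFaces, mem_filter, mem_sdiff] at hσ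
    exact hσ.1.1

/-- `K'` is obtained from `K` by `m` stellar subdivisions at facets of the relative
complex, all of which leave the removed subcomplex `L` unchanged. -/
inductive FacetSubdivides (L : Finset (Finset V)) :
    ℕ → Finset (Finset V) → Finset (Finset V) → Prop
  | refl (K) : FacetSubdivides L 0 K K
  | step {m K K'} (θ : Finset V) (v : V) : FacetSubdivides L m K K' →
      IsFacetOf (relFaces K' L) θ → (∀ τ ∈ K', v ∉ τ) → stellar L θ v = L →
      FacetSubdivides L (m + 1) K (stellar K' θ v)

namespace FacetSubdivides

theorem trans {L K K' K'' : Finset (Finset V)} {m m' : ℕ} (h : FacetSubdivides L m K K')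
    (h' : FacetSubdivides L m' K' K'') : FacetSubdivides L (m + m') K K'' := by
  induction h' with
  | refl => exact h
  | step θ v _ h1 h2 h3 ih => exact (ih h).step θ v h1 h2 h3

theorem exists_seq [Nonempty V] {L K K' : Finset (Finset V)} {m : ℕ}
    (h : FacetSubdivides L m K K') :
    ∃ (F : ℕ → Finset (Finset V)) (θ : ℕ → Finset V) (v : ℕ → V),
      F 0 = K ∧ F m = K' ∧ ∀ i < m, IsFacetOf (relFaces (F i) L) (θ i) ∧
        (∀ τ ∈ F i, v i ∉ τ) ∧ F (i + 1) = stellar (F i) (θ i) (v i) ∧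
        L = stellar L (θ i) (v i) := by
  induction h with
  | refl K => exact ⟨fun _ => K, fun _ => ∅, fun _ => Classical.arbitrary V, rfl, rfl, by simp⟩
  | @step m K K' θ₀ v₀ _ h1 h2 h3 ih =>
    obtain ⟨F, θ, v, hF0, hFm, hF⟩ := ih
    refine ⟨Function.update F (m + 1) (stellar K' θ₀ v₀), Function.update θ m θ₀,
      Function.update v m v₀, by simpa using hF0, by simp, fun i hi => ?_⟩
    rcases Nat.lt_succ_iff_lt_or_eq.1 hi with hi' | rfl
    · have e1 : i ≠ m + 1 := by omega
      have e2 : i ≠ m := by omega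
      have e3 : i + 1 ≠ m + 1 := by omega
      simpa [Function.update_of_ne, e1, e2] using hF i hi'
    · have e1 : i ≠ i + 1 := by omega
      simpa [Function.update_of_ne, e1, hFm] using And.intro h1 (And.intro h2 h3.symm)

end FacetSubdivides

/-! ### Shelling orders and refinements -/

/-- No face of a tile lies in the underlying simplex of an earlier tile. -/
def ShellOrder (ts : List (MorseTile V)) : Prop :=
  ts.Pairwise fun T T' => ∀ τ ∈ T'.faceSet, ¬ τ ⊆ T.simplex

theorem ShellOrder.isMorseShelling {ts : List (MorseTile V)} (h : ShellOrder ts) {c : ℕ}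
    (hc : ∀ T ∈ ts, T.simplex.card = c) : IsMorseShelling (faceUnion ts) ts := by
  refine ⟨⟨?_, rfl, fun d => ?_⟩, fun p => ?_⟩
  · refine h.imp fun {T T'} hT => disjoint_left.2 fun τ h1 h2 => ?_
    exact hT τ h2 (MorseTile.subset_simplex h1)
  · intro τ hτ _ α hα _
    rw [mem_faceUnion] at hτ hα ⊢
    obtain ⟨T, hT, hτT⟩ := hτ
    obtain ⟨T', hT', -⟩ := hα
    refine ⟨T, ?_, hτT⟩
    simp only [List.mem_filter, decide_eq_true_eq] at hT' ⊢
    have hd : T.dim = T'.dim := by rw [MorseTile.dim, MorseTile.dim, hc _ hT, hc _ hT'.1]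
    exact ⟨hT, hd ▸ hT'.2⟩
  · intro τ hτ _ α hα hτα
    rw [mem_faceUnion] at hτ hα ⊢
    obtain ⟨T, hT, hτT⟩ := hτ
    obtain ⟨T', hT', hαT'⟩ := hα
    by_cases hp : T ∈ ts.take p
    · exact ⟨T, hp, hτT⟩
    · have hd : T ∈ ts.drop p := by
        rw [← List.take_append_drop p ts, List.mem_append] at hT
        exact hT.resolve_left hp
      rw [ShellOrder, ← List.take_append_drop p ts, List.pairwise_append] at h
      exact absurd (hτα.trans (MorseTile.subset_simplex hαT')) (h.2.2 _ hT' _ hd τ hτT)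

/-- A family `ms` of tiles of `K ∖ L` is replaced by a shelled family `ts` of tiles of
`K' ∖ L`, where `K'` results from `m` stellar subdivisions of `K` at facets. -/
structure Refines (L K : Finset (Finset V)) (ms : List (MorseTile V)) (m : ℕ)
    (K' : Finset (Finset V)) (ts : List (MorseTile V)) : Prop where
  subdivides : FacetSubdivides L m K K'
  isComplex : IsComplex K'
  removed_subset : L ⊆ K'
  shellOrder : ShellOrder ts
  mem_iff : ∀ τ, τ ∈ K' ↔
    (τ ∈ K ∧ ∀ T ∈ ms, τ ∉ T.faceSet) ∨ ∃ T ∈ ts, τ ∈ T.faceSet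
  simplex : ∀ T' ∈ ts, ∃ T ∈ ms, T'.simplex.card = T.simplex.card ∧
    ∀ x ∈ T'.simplex, x ∈ T.simplex ∨ ∀ ρ ∈ K, x ∉ ρ
  face : ∀ T' ∈ ts, ∀ τ ∈ T'.faceSet,
    (∃ T ∈ ms, τ ∈ T.faceSet) ∨ ∃ x ∈ τ, ∀ ρ ∈ K, x ∉ ρ
  fresh : ∀ x, (∀ ρ ∈ K', x ∉ ρ) → ∀ ρ ∈ K, x ∉ ρ

namespace Refines

theorem refl {L K : Finset (Finset V)} {ms : List (MorseTile V)} (hK : IsComplex K)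
    (hL : L ⊆ K) (hms : ShellOrder ms) (h : ∀ T ∈ ms, T.simplex ∈ K) :
    Refines L K ms 0 K ms where
  subdivides := .refl K
  isComplex := hK
  removed_subset := hL
  shellOrder := hms
  mem_iff τ := by
    constructor
    · intro hτ
      by_cases h' : ∃ T ∈ ms, τ ∈ T.faceSet
      · exact .inr h'
      · exact .inl ⟨hτ, fun T hT hτT => h' ⟨T, hT, hτT⟩⟩
    · rintro (h' | ⟨T, hT, hτ⟩)
      · exact h'.1
      · exact hK _ (h T hT) _ (MorseTile.subset_simplex hτ)
  simplex T hT := ⟨T, hT, rfl, fun _ hx => .inl hx⟩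
  face T hT _ hτ := .inl ⟨T, hT, hτ⟩
  fresh _ h := h

theorem subset_of_subset_simplex {L K K' : Finset (Finset V)} {ms ts : List (MorseTile V)}
    {m : ℕ} (h : Refines L K ms m K' ts) {T' : MorseTile V} (hT' : T' ∈ ts) :
    ∃ T ∈ ms, ∀ τ ∈ K, τ ⊆ T'.simplex → τ ⊆ T.simplex := by
  obtain ⟨T, hT, -, hx⟩ := h.simplex T' hT'
  exact ⟨T, hT, fun τ hτ hs x hxτ => (hx x (hs hxτ)).resolve_right fun h' => h' τ hτ hxτ⟩

theorem trans {L K K' K'' : Finset (Finset V)} {rs ms ts : List (MorseTile V)} {m m' : ℕ}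
    (h : Refines L K rs m K' ms) (h' : Refines L K' ms m' K'' ts) :
    Refines L K rs (m + m') K'' ts where
  subdivides := h.subdivides.trans h'.subdivides
  isComplex := h'.isComplex
  removed_subset := h'.removed_subset
  shellOrder := h'.shellOrder
  mem_iff τ := by
    rw [h'.mem_iff, h.mem_iff]
    constructor
    · rintro (⟨h1 | ⟨T, hT, hτ⟩, h2⟩ | h1)
      · exact .inl h1
      · exact absurd hτ (h2 T hT)
      · exact .inr h1
    · rintro (h1 | h1)
      · refine .inl ⟨.inl h1, fun T hT hτ => ?_⟩
        rcases h.face T hT τ hτ with ⟨T', hT', hτ'⟩ | ⟨x, hx, hx'⟩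
        · exact h1.2 T' hT' hτ'
        · exact hx' τ h1.1 hx
      · exact .inr h1
  simplex T'' hT'' := by
    obtain ⟨T', hT', hc', hs'⟩ := h'.simplex T'' hT''
    obtain ⟨T, hT, hc, hs⟩ := h.simplex T' hT'
    exact ⟨T, hT, hc'.trans hc, fun x hx =>
      (hs' x hx).elim (hs x) fun hf => .inr (h.fresh x hf)⟩
  face T'' hT'' τ hτ := by
    rcases h'.face T'' hT'' τ hτ with ⟨T', hT', hτ'⟩ | ⟨x, hx, hf⟩
    · exact h.face T' hT' τ hτ'
    · exact .inr ⟨x, hx, h.fresh x hf⟩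
  fresh x hx := h.fresh x (h'.fresh x hx)

theorem append {L K K' K'' : Finset (Finset V)} {ms ms' ts ts' : List (MorseTile V)}
    {m m' : ℕ} (hK : IsComplex K) (hms' : ∀ T ∈ ms', T.simplex ∈ K)
    (hs : ShellOrder (ms ++ ms')) (h : Refines L K ms m K' ts)
    (h' : Refines L K' ms' m' K'' ts') :
    Refines L K (ms ++ ms') (m + m') K'' (ts ++ ts') := by
  have hface : ∀ T ∈ ms', ∀ τ ∈ T.faceSet, τ ∈ K := fun T hT τ hτ =>
    hK _ (hms' T hT) _ (MorseTile.subset_simplex hτ)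
  have hsep : ∀ T ∈ ts, ∀ T' ∈ ms', ∀ τ ∈ T'.faceSet, ¬ τ ⊆ T.simplex := by
    intro T hT T' hT' τ hτ hτT
    obtain ⟨T₀, hT₀, hsub⟩ := h.subset_of_subset_simplex hT
    exact (List.pairwise_append.1 hs).2.2 T₀ hT₀ T' hT' τ hτ (hsub τ (hface T' hT' τ hτ) hτT)
  refine ⟨h.subdivides.trans h'.subdivides, h'.isComplex, h'.removed_subset, ?_, fun τ => ?_,
    fun T hT => ?_, fun T hT τ hτ => ?_, fun x hx => h.fresh x (h'.fresh x hx)⟩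
  · refine List.pairwise_append.2 ⟨h.shellOrder, h'.shellOrder, fun T hT T' hT' τ hτ hτT => ?_⟩
    rcases h'.face T' hT' τ hτ with ⟨T₁, hT₁, hτ₁⟩ | ⟨x, hx, hf⟩
    · exact hsep T hT T₁ hT₁ τ hτ₁ hτT
    · exact hf _ ((h.mem_iff _).2 (.inr ⟨T, hT, T.simplex_mem_faceSet⟩)) (hτT hx)
  · rw [h'.mem_iff, h.mem_iff]
    simp only [List.mem_append]
    constructor
    · rintro (⟨h1 | ⟨T, hT, hτ⟩, h2⟩ | ⟨T, hT, hτ⟩)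
      · exact .inl ⟨h1.1, fun T hT => hT.elim (h1.2 T) (h2 T)⟩
      · exact .inr ⟨T, .inl hT, hτ⟩
      · exact .inr ⟨T, .inr hT, hτ⟩
    · rintro (h1 | ⟨T, hT | hT, hτ⟩)
      · exact .inl ⟨.inl ⟨h1.1, fun T hT => h1.2 T (.inl hT)⟩, fun T hT => h1.2 T (.inr hT)⟩
      · exact .inl ⟨.inr ⟨T, hT, hτ⟩, fun T' hT' hτ' =>
          hsep T hT T' hT' τ hτ' (MorseTile.subset_simplex hτ)⟩
      · exact .inr ⟨T, hT, hτ⟩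
  · rcases List.mem_append.1 hT with hT | hT
    · obtain ⟨T₀, hT₀, hx⟩ := h.simplex T hT
      exact ⟨T₀, List.mem_append_left _ hT₀, hx⟩
    · obtain ⟨T₀, hT₀, hc, hx⟩ := h'.simplex T hT
      exact ⟨T₀, List.mem_append_right _ hT₀, hc, fun x hxT => (hx x hxT).imp_right (h.fresh x)⟩
  · rcases List.mem_append.1 hT with hT | hT
    · exact (h.face T hT τ hτ).imp_left fun ⟨T₀, hT₀, h0⟩ => ⟨T₀, List.mem_append_left _ hT₀, h0⟩
    · rcases h'.face T hT τ hτ with ⟨T₀, hT₀, h0⟩ | ⟨x, hx, hf⟩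
      · exact .inl ⟨T₀, List.mem_append_right _ hT₀, h0⟩
      · exact .inr ⟨x, hx, h.fresh x hf⟩

theorem isFacetOf {L K K' : Finset (Finset V)} {ms ts : List (MorseTile V)} {m : ℕ}
    (h : Refines L K ms m K' ts) {σ : Finset V} (hσ : IsFacetOf K σ)
    (hms : ∀ T ∈ ms, ¬ σ ⊆ T.simplex) : IsFacetOf K' σ := by
  refine ⟨(h.mem_iff σ).2 (.inl ⟨hσ.1, fun T hT hσT =>
    hms T hT (MorseTile.subset_simplex hσT)⟩), fun τ hτ hστ => ?_⟩
  rcases (h.mem_iff τ).1 hτ with h1 | ⟨T', hT', hτT'⟩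
  · exact hσ.2 τ h1.1 hστ
  · obtain ⟨T, hT, hsub⟩ := h.subset_of_subset_simplex hT'
    exact absurd (hsub σ hσ.1 (hστ.trans (MorseTile.subset_simplex hτT'))) (hms T hT)

end Refines

/-! ### Counting critical tiles -/

/-- The tiles are basic or critical, and the critical ones are counted by index by the
binomial coefficients of order `m`, shifted by `a`. -/
structure BinomialCritical (ts : List (MorseTile V)) (a m : ℕ) : Prop where
  isHTile : ∀ T ∈ ts, T.IsHTile
  total : totalCritical ts = 2 ^ m
  count : ∀ i, criticalCount ts i = if a ≤ i then m.choose (i - a) else 0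

namespace BinomialCritical

theorem append {ts ts' : List (MorseTile V)} {a m : ℕ} (h : BinomialCritical ts a m)
    (h' : BinomialCritical ts' (a + 1) m) : BinomialCritical (ts ++ ts') a (m + 1) where
  isHTile T hT := (List.mem_append.1 hT).elim (h.isHTile T) (h'.isHTile T)
  total := by
    have h1 := h.total
    have h2 := h'.total
    simp only [totalCritical, List.countP_append] at *
    rw [h1, h2, pow_succ]
    ring
  count i := by
    have h1 := h.count i
    have h2 := h'.count i
    simp only [criticalCount, List.countP_append] at *
    rw [h1, h2]
    rcases lt_trichotomy i a with hi | rfl | hi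
    · simp [show ¬ a ≤ i by omega, show ¬ a + 1 ≤ i by omega]
    · simp
    · obtain ⟨j, rfl⟩ := Nat.exists_eq_add_of_lt hi
      simp [show a ≤ a + j + 1 by omega, show a + j + 1 - a = j + 1 by omega,
        Nat.choose_succ_succ, add_comm]

theorem cons_noncritical {T : MorseTile V} {ts : List (MorseTile V)} {a m : ℕ}
    (hT : T.morse = none) (hT' : T.res ≠ T.simplex) (h : BinomialCritical ts a m) :
    BinomialCritical (T :: ts) a m where
  isHTile := by
    simp only [List.mem_cons, forall_eq_or_imp]
    exact ⟨.inl hT, h.isHTile⟩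
  total := by
    rw [← h.total]
    simp [totalCritical, MorseTile.IsCritical, hT, hT']
  count i := by
    rw [← h.count i]
    simp [criticalCount, MorseTile.IsCritical, hT, hT']

theorem cons_critical {T : MorseTile V} {ts : List (MorseTile V)}
    (hT : T.morse = some T.res) (h : ∀ T ∈ ts, T.morse = none ∧ T.res ≠ T.simplex) :
    BinomialCritical (T :: ts) T.res.card 0 where
  isHTile := by
    simp only [List.mem_cons, forall_eq_or_imp]
    exact ⟨.inr hT, fun T hT => .inl (h T hT).1⟩
  total := by
    have h0 : totalCritical ts = 0 := by
      simp only [totalCritical, List.countP_eq_zero, MorseTile.IsCritical]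
      intro T hT
      simp [h T hT]
    rw [totalCritical] at h0
    simp [totalCritical, MorseTile.IsCritical, hT] at h0 ⊢
    simpa using h0
  count i := by
    have h0 : criticalCount ts i = 0 := by
      simp only [criticalCount, List.countP_eq_zero, MorseTile.IsCritical]
      intro T hT
      simp [h T hT]
    have hne : T.res ≠ T.simplex := (T.morse_ssub _ hT).ne
    rw [criticalCount] at h0
    rw [criticalCount, List.countP_cons, h0]
    simp only [MorseTile.IsCritical, hT, MorseTile.index, hne, if_false, true_or, true_and,
      decide_eq_true_eq]
    rcases lt_trichotomy i T.res.card with hi | rfl | hi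
    · simp [hi.ne', hi.not_ge]
    · simp
    · simp [hi.ne, hi.le, Nat.choose_eq_zero_of_lt, hi]

theorem index_bounds {ts : List (MorseTile V)} {a m : ℕ} (h : BinomialCritical ts a m)
    {T : MorseTile V} (hT : T ∈ ts) (hc : T.IsCritical) :
    a ≤ T.index ∧ T.index ≤ a + m := by
  have hpos : 0 < criticalCount ts T.index :=
    List.countP_pos_iff.2 ⟨T, hT, by simp [hc]⟩
  rw [h.count] at hpos
  split_ifs at hpos with h1
  · by_contra h2
    rw [Nat.choose_eq_zero_of_lt (by omega)] at hpos
    exact hpos.false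
  · omega

end BinomialCritical

/-! ### Tilings of the cone over the boundary of a simplex -/

/-- `ms` lists the tiles, on the simplices `v * (σ \ x)` for `x` in `xs`, of the part of the
cone over the boundary of `σ` that contains `A`. Faces without the apex `v` are kept only if
they contain `R` and are not contained in `μ`. -/
inductive IsConeTiling (v : V) (σ R μ : Finset V) :
    Finset V → List V → List (MorseTile V) → Prop
  | nil (A) : IsConeTiling v σ R μ A [] []
  | cons {A x xs T ms} : T.simplex = insert v (σ.erase x) →
      (∀ τ, τ ∈ T.faceSet ↔
        τ ⊆ insert v σ ∧ x ∉ τ ∧ A ⊆ τ ∧ (v ∈ τ ∨ R ⊆ τ ∧ ¬ τ ⊆ μ)) →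
      IsConeTiling v σ R μ (insert x A) xs ms → IsConeTiling v σ R μ A (x :: xs) (T :: ms)

namespace IsConeTiling

theorem exists_mem_faceSet_iff {v : V} {σ R μ A : Finset V} {xs : List V}
    {ms : List (MorseTile V)} (h : IsConeTiling v σ R μ A xs ms) (τ : Finset V) :
    (∃ T ∈ ms, τ ∈ T.faceSet) ↔
      τ ⊆ insert v σ ∧ A ⊆ τ ∧ (∃ x ∈ xs, x ∉ τ) ∧ (v ∈ τ ∨ R ⊆ τ ∧ ¬ τ ⊆ μ) := by
  induction h with
  | nil => simp
  | @cons A x xs T ms h1 h2 h3 ih =>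
    simp only [List.mem_cons, exists_eq_or_imp, h2, ih, insert_subset_iff]
    by_cases hx : x ∈ τ <;> simp [hx]

theorem exists_simplex_eq {v : V} {σ R μ A : Finset V} {xs : List V}
    {ms : List (MorseTile V)} (h : IsConeTiling v σ R μ A xs ms) :
    ∀ T ∈ ms, ∃ x ∈ xs, T.simplex = insert v (σ.erase x) := by
  induction h with
  | nil => simp
  | @cons A x xs T ms h1 h2 h3 ih =>
    simp only [List.mem_cons, forall_eq_or_imp, exists_eq_or_imp]
    exact ⟨.inl h1, fun T' hT' => .inr (ih T' hT')⟩

theorem shellOrder {v : V} {σ R μ A : Finset V} {xs : List V}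
    {ms : List (MorseTile V)} (h : IsConeTiling v σ R μ A xs ms) (hv : v ∉ xs) :
    ShellOrder ms := by
  induction h with
  | nil => exact List.Pairwise.nil
  | @cons A x xs T ms h1 h2 h3 ih =>
    simp only [List.mem_cons, not_or] at hv
    refine List.pairwise_cons.2 ⟨fun T' hT' τ hτ hs => ?_, ih hv.2⟩
    have hx : x ∈ τ :=
      ((h3.exists_mem_faceSet_iff τ).1 ⟨T', hT', hτ⟩).2.1 (mem_insert_self x A)
    have := hs hx
    rw [h1] at this
    simp [Ne.symm hv.1] at this

theorem exists_basic {v : V} {σ R μ : Finset V} (hv : v ∉ σ) (hR : R ⊆ μ) (xs : List V) :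
    ∀ A : Finset V, μ ⊂ A → A ⊆ σ → xs.Nodup → (∀ x ∈ xs, x ∈ σ ∧ x ∉ A) →
      ∃ ms, IsConeTiling v σ R μ A xs ms ∧ ∀ T ∈ ms, T.morse = none ∧ T.res ≠ T.simplex := by
  induction xs with
  | nil => exact fun A _ _ _ _ => ⟨[], .nil A, by simp⟩
  | cons x xs ih =>
    intro A hA hAσ hnd hxs
    simp only [List.nodup_cons, List.mem_cons, forall_eq_or_imp] at hnd hxs
    obtain ⟨ms, hms, hb⟩ := ih (insert x A) (hA.trans_subset (subset_insert x A))
      (insert_subset hxs.1.1 hAσ) hnd.2 (by grind)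
    have hres : A ⊆ insert v (σ.erase x) := by grind
    let T : MorseTile V := ⟨insert v (σ.erase x), A, none, insert_nonempty _ _, hres,
      by simp, by simp, by simp⟩
    have hxv : x ≠ v := fun e => hv (e ▸ hxs.1.1)
    refine ⟨T :: ms, .cons rfl (fun τ => ?_) hms, ?_⟩
    · rw [MorseTile.mem_faceSet_of_none rfl]
      change τ ⊆ insert v (σ.erase x) ∧ A ⊆ τ ∧ τ ≠ ∅ ↔ _
      constructor
      · rintro ⟨h1, h2, -⟩
        exact ⟨by grind, by grind, h2, .inr ⟨hR.trans (hA.1.trans h2),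
          fun h => hA.2 (h2.trans h)⟩⟩
      · rintro ⟨h1, h2, h3, -⟩
        refine ⟨by grind, h3, ?_⟩
        rintro rfl
        exact hA.2 (h3.trans (empty_subset _))
    · simp only [List.mem_cons, forall_eq_or_imp]
      refine ⟨⟨rfl, fun e => hv (hAσ ?_)⟩, hb⟩
      change A = insert v (σ.erase x) at e
      rw [e]
      exact mem_insert_self _ _

theorem exists_critical {v : V} {σ R μ : Finset V} (hv : v ∉ σ) (hR : R ⊆ μ) (hμ : μ ⊂ σ)
    (hcard : μ.card + 2 ≤ σ.card) {ys : List V} (hnd : ys.Nodup)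
    (hys : ∀ y, y ∈ ys ↔ y ∈ σ ∧ y ∉ μ) :
    ∃ ms, IsConeTiling v σ R μ μ ys ms ∧ BinomialCritical ms μ.card 0 := by
  cases ys with
  | nil =>
    obtain ⟨y, hy⟩ := exists_of_ssubset hμ
    exact absurd ((hys y).2 hy) (by simp)
  | cons x xs =>
    have hx := (hys x).1 (by simp)
    simp only [List.nodup_cons] at hnd
    obtain ⟨ms, hms, hb⟩ := exists_basic hv hR xs (insert x μ) (ssubset_insert hx.2)
      (insert_subset hx.1 hμ.1) hnd.2 (by grind)
    have hxv : x ≠ v := fun e => hv (e ▸ hx.1)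
    have hc : (insert v (σ.erase x)).card = σ.card := by
      rw [card_insert_of_notMem (by simp [hv]), card_erase_add_one hx.1]
    have hvμ : v ∉ μ := fun h => hv (hμ.1 h)
    have hres : μ ⊆ insert v (σ.erase x) := by
      have := hμ.1
      grind
    let T : MorseTile V := ⟨insert v (σ.erase x), μ, some μ, insert_nonempty _ _, hres,
      by simp, by
        simp only [Option.mem_def, Option.some.injEq, forall_eq']
        exact ⟨hres, fun h => hvμ (h (mem_insert_self _ _))⟩, by
        simp only [Option.mem_def, Option.some.injEq, forall_eq']
        omega⟩
    refine ⟨T :: ms, .cons rfl (fun τ => ?_) hms, BinomialCritical.cons_critical rfl hb⟩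
    rw [MorseTile.mem_faceSet_of_some rfl]
    change τ ⊆ insert v (σ.erase x) ∧ μ ⊆ τ ∧ ¬ τ ⊆ μ ↔ _
    constructor
    · rintro ⟨h1, h2, h3⟩
      exact ⟨by grind, by grind, h2, .inr ⟨hR.trans h2, h3⟩⟩
    · rintro ⟨h1, h2, h3, h4⟩
      exact ⟨by grind, h3, by grind⟩

end IsConeTiling

/-- Tiles `ms` whose simplices are facets can be refined to basic and critical tiles by `s`
subdivisions, with critical tiles counted by shifted binomial coefficients. -/
def RefinesToBinomial (L : Finset (Finset V)) (ms : List (MorseTile V)) (s a m : ℕ) : Prop :=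
  ∀ K, IsComplex K → L ⊆ K → (∀ T ∈ ms, IsFacetOf K T.simplex ∧ T.simplex ∉ L) →
    ∃ K' ts, Refines L K ms s K' ts ∧ BinomialCritical ts a m

/-- Every tile of order `a` whose Morse face has `a + e` vertices is refined by `2 ^ (e - 1)`
subdivisions (none if `e = 0`). -/
def MorseRefinable (L : Finset (Finset V)) (e : ℕ) : Prop :=
  ∀ (T : MorseTile V) (μ : Finset V), T.morse = some μ → μ.card = T.res.card + e →
    RefinesToBinomial L [T] (2 ^ e / 2) T.res.card e

theorem ShellOrder.refinesToBinomial_cons {L : Finset (Finset V)} {T : MorseTile V}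
    {ms : List (MorseTile V)} {s s' a m : ℕ} (hs : ShellOrder (T :: ms))
    (h : RefinesToBinomial L [T] s a m) (h' : RefinesToBinomial L ms s' (a + 1) m) :
    RefinesToBinomial L (T :: ms) (s + s') a (m + 1) := by
  intro K hK hLK hfac
  simp only [List.mem_cons, forall_eq_or_imp] at hfac
  obtain ⟨K₁, ts₁, hr₁, hb₁⟩ := h K hK hLK (by simpa using hfac.1)
  obtain ⟨K₂, ts₂, hr₂, hb₂⟩ := h' K₁ hr₁.isComplex hr₁.removed_subset fun T' hT' =>
    ⟨hr₁.isFacetOf (hfac.2 T' hT').1 (by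
      simpa using (List.pairwise_cons.1 hs).1 T' hT' _ T'.simplex_mem_faceSet),
      (hfac.2 T' hT').2⟩
  exact ⟨K₂, ts₁ ++ ts₂, hr₁.append (ms := [T]) hK (fun T' hT' => (hfac.2 T' hT').1.1) hs hr₂,
    hb₁.append hb₂⟩

theorem ShellOrder.refinesToBinomial_cons_noncritical {L : Finset (Finset V)}
    {T : MorseTile V} {ms : List (MorseTile V)} {s a m : ℕ} (hs : ShellOrder (T :: ms))
    (hT : T.morse = none) (hT' : T.res ≠ T.simplex) (h : RefinesToBinomial L ms s a m) :
    RefinesToBinomial L (T :: ms) s a m := by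
  intro K hK hLK hfac
  simp only [List.mem_cons, forall_eq_or_imp] at hfac
  obtain ⟨K₂, ts₂, hr₂, hb₂⟩ := h K hK hLK hfac.2
  have hr₁ : Refines L K [T] 0 K [T] :=
    .refl hK hLK (List.pairwise_singleton _ _) (by simpa using hfac.1.1.1)
  have := hr₁.append hK (fun T' hT' => (hfac.2 T' hT').1.1) hs hr₂
  rw [Nat.zero_add] at this
  exact ⟨K₂, T :: ts₂, this, hb₂.cons_noncritical hT hT'⟩

namespace IsConeTiling

theorem exists_refinable_morse {L : Finset (Finset V)} {v : V} {σ R μ : Finset V} {e : ℕ}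
    (hrec : ∀ e' < e, MorseRefinable L e') (hv : v ∉ σ) (hR : R ⊆ μ) (hμ : μ ⊂ σ)
    (hcard : μ.card + 2 ≤ σ.card) {ys : List V} (hnd : ys.Nodup)
    (hys : ∀ y, y ∈ ys ↔ y ∈ σ ∧ y ∉ μ) (xs : List V) :
    ∀ A : Finset V, R ⊆ A → A ⊆ μ → xs.Nodup → (∀ x, x ∈ xs ↔ x ∈ μ ∧ x ∉ A) →
      xs.length ≤ e → ∃ ms, IsConeTiling v σ R μ A (xs ++ ys) ms ∧
        RefinesToBinomial L ms (2 ^ xs.length / 2 - 1) A.card xs.length := by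
  induction xs with
  | nil =>
    intro A _ hAμ _ hxs _
    obtain rfl : A = μ := hAμ.antisymm fun x hx => by
      by_contra h
      exact absurd ((hxs x).2 ⟨hx, h⟩) (by simp)
    obtain ⟨ms, hms, hb⟩ := exists_critical hv hR hμ hcard hnd hys
    refine ⟨ms, hms, fun K hK hLK hfac => ⟨K, ms, ?_, hb⟩⟩
    rw [List.length_nil, show 2 ^ 0 / 2 - 1 = 0 by norm_num]
    exact .refl hK hLK (hms.shellOrder fun h => hv ((hys v).1 h).1) fun T hT => (hfac T hT).1.1
  | cons x xs ih =>
    intro A hRA hAμ hndx hxs hlen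
    have hx := (hxs x).1 (by simp)
    have hμσ := hμ.1
    have hxσ := hμσ hx.1
    simp only [List.nodup_cons, List.length_cons] at hndx hlen
    obtain ⟨ms, hms, hb⟩ := ih (insert x A) (hRA.trans (subset_insert x A))
      (insert_subset hx.1 hAμ) hndx.2 (by grind) (by omega)
    rw [card_insert_of_notMem hx.2] at hb
    have hxv : x ≠ v := fun e => hv (e ▸ hxσ)
    have hc : (insert v (σ.erase x)).card = σ.card := by
      rw [card_insert_of_notMem (by simp [hv]), card_erase_add_one hxσ]
    have hvμ : v ∉ μ := fun h => hv (hμσ h)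
    have hAe : A ⊆ μ.erase x := subset_erase.2 ⟨hAμ, hx.2⟩
    have hμe : μ.erase x ⊆ insert v (σ.erase x) :=
      (erase_subset_erase x hμσ).trans (subset_insert _ _)
    have hce : (μ.erase x).card + 1 = μ.card := card_erase_add_one hx.1
    let T : MorseTile V := ⟨insert v (σ.erase x), A, some (μ.erase x), insert_nonempty _ _,
      hAe.trans hμe, by simpa using hAe, by
        simp only [Option.mem_def, Option.some.injEq, forall_eq']
        exact ⟨hμe, fun h => hvμ (mem_of_mem_erase (h (mem_insert_self _ _)))⟩, by
        simp only [Option.mem_def, Option.some.injEq, forall_eq']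
        omega⟩
    have hcone : IsConeTiling v σ R μ A (x :: (xs ++ ys)) (T :: ms) := by
      refine .cons rfl (fun τ => ?_) hms
      rw [MorseTile.mem_faceSet_of_some rfl]
      change τ ⊆ insert v (σ.erase x) ∧ A ⊆ τ ∧ ¬ τ ⊆ μ.erase x ↔ _
      constructor
      · rintro ⟨h1, h2, h3⟩
        have hxτ : x ∉ τ := by grind
        exact ⟨by grind, hxτ, h2, .inr ⟨hRA.trans h2, fun h => h3 (subset_erase.2 ⟨h, hxτ⟩)⟩⟩
      · rintro ⟨h1, h2, h3, h4⟩
        exact ⟨by grind, h3, by grind⟩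
    have hs : ShellOrder (T :: ms) := hcone.shellOrder (by grind)
    have hlenA : μ.card = A.card + (xs.length + 1) := by
      have h1 : (x :: xs).toFinset = μ \ A := by
        ext z
        rw [List.mem_toFinset, hxs, mem_sdiff]
      have h2 := List.toFinset_card_of_nodup (List.nodup_cons.2 hndx)
      rw [h1, card_sdiff_of_subset hAμ, List.length_cons] at h2
      have := card_le_card hAμ
      omega
    have hT : RefinesToBinomial L [T] (2 ^ xs.length / 2) A.card xs.length :=
      hrec xs.length (by omega) T (μ.erase x) rfl (by change _ = A.card + _; omega)
    refine ⟨T :: ms, hcone, ?_⟩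
    have hnum : 2 ^ (x :: xs).length / 2 - 1 =
        2 ^ xs.length / 2 + (2 ^ xs.length / 2 - 1) := by
      rw [List.length_cons]
      rcases xs.length with _ | j
      · rfl
      · have := Nat.two_pow_pos j
        rw [pow_succ, pow_succ]
        omega
    rw [hnum]
    exact hs.refinesToBinomial_cons hT hb

theorem exists_refinable {L : Finset (Finset V)} {v : V} {σ R μ : Finset V} {e : ℕ}
    (hv : v ∉ σ) (hR : R ⊆ μ) (hμ : μ ⊂ σ) {zs : List V}
    (hzs : ∀ z, z ∈ zs ↔ z ∈ σ ∧ z ∉ R) (xs : List V)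
    (hbase : ∃ ms, IsConeTiling v σ R μ R zs ms ∧
      RefinesToBinomial L ms (2 ^ e / 2 - 1) R.card e) :
    ∀ A : Finset V, A ⊆ R → xs.Nodup → (∀ x, x ∈ xs ↔ x ∈ R ∧ x ∉ A) →
      ∃ ms, IsConeTiling v σ R μ A (xs ++ zs) ms ∧
        RefinesToBinomial L ms (2 ^ e / 2 - 1) R.card e := by
  induction xs with
  | nil =>
    intro A hA _ hxs
    obtain rfl : A = R := hA.antisymm fun x hx => by
      by_contra h
      exact absurd ((hxs x).2 ⟨hx, h⟩) (by simp)
    exact hbase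
  | cons x xs ih =>
    intro A hA hndx hxs
    have hx := (hxs x).1 (by simp)
    have hμσ := hμ.1
    have hRσ := hR.trans hμσ
    have hxσ := hRσ hx.1
    simp only [List.nodup_cons] at hndx
    obtain ⟨ms, hms, hb⟩ := ih (insert x A) (insert_subset hx.1 hA) hndx.2 (by grind)
    have hxv : x ≠ v := fun e => hv (e ▸ hxσ)
    have hres : insert v A ⊆ insert v (σ.erase x) := by grind
    let T : MorseTile V := ⟨insert v (σ.erase x), insert v A, none, insert_nonempty _ _,
      hres, by simp, by simp, by simp⟩
    have hcone : IsConeTiling v σ R μ A (x :: (xs ++ zs)) (T :: ms) := by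
      refine .cons rfl (fun τ => ?_) hms
      rw [MorseTile.mem_faceSet_of_none rfl]
      change τ ⊆ insert v (σ.erase x) ∧ insert v A ⊆ τ ∧ τ ≠ ∅ ↔ _
      constructor
      · rintro ⟨h1, h2, h3⟩
        exact ⟨by grind, by grind, by grind, by grind⟩
      · rintro ⟨h1, h2, h3, h4⟩
        have hvτ : v ∈ τ := h4.elim id fun h => absurd (h.1 hx.1) h2
        exact ⟨by grind, insert_subset hvτ h3, ne_empty_of_mem hvτ⟩
    refine ⟨T :: ms, hcone, (hcone.shellOrder (by grind)).refinesToBinomial_cons_noncritical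
      rfl ?_ hb⟩
    change insert v A ≠ insert v (σ.erase x)
    obtain ⟨y, hy, hy'⟩ := exists_of_ssubset hμ
    intro heq
    have : y ∈ insert v (σ.erase x) := by grind
    rw [← heq] at this
    grind

end IsConeTiling

theorem refines_stellar {L K : Finset (Finset V)} {T : MorseTile V} {μ : Finset V} {v : V}
    {xs : List V} {ms : List (MorseTile V)} (hL : IsComplex L) (hK : IsComplex K)
    (hLK : L ⊆ K) (hT : T.morse = some μ) (hfac : IsFacetOf K T.simplex)
    (hTL : T.simplex ∉ L) (hv : ∀ τ ∈ K, v ∉ τ) (hxs : ∀ x, x ∈ xs ↔ x ∈ T.simplex)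
    (hms : IsConeTiling v T.simplex T.res μ ∅ xs ms) :
    Refines L K [T] 1 (stellar K T.simplex v) ms ∧
      ∀ T' ∈ ms, IsFacetOf (stellar K T.simplex v) T'.simplex ∧ T'.simplex ∉ L := by
  have hvσ : v ∉ T.simplex := hv _ hfac.1
  have hmem := fun τ => mem_stellar_of_isFacetOf (τ := τ) (v := v) hK hfac
  have hsimp : ∀ T' ∈ ms, ∃ x ∈ T.simplex, T'.simplex = insert v (T.simplex.erase x) := by
    intro T' hT'
    obtain ⟨x, hx, h⟩ := hms.exists_simplex_eq T' hT'
    exact ⟨x, (hxs x).1 hx, h⟩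
  refine ⟨⟨(FacetSubdivides.refl K).step _ v (hfac.relFaces hTL T.simplex_nonempty) hv
    (stellar_of_notMem hL hTL), hK.stellar hfac, fun τ hτ => ?_, hms.shellOrder ?_, fun τ => ?_,
    fun T' hT' => ?_, fun T' hT' τ hτ => ?_, fun x hx ρ hρ hxρ => ?_⟩, fun T' hT' => ?_⟩
  · exact (hmem τ).2 (.inl ⟨hLK hτ, fun h => hTL (h ▸ hτ)⟩)
  · rwa [hxs]
  · rw [hmem, hms.exists_mem_faceSet_iff]
    simp only [List.mem_singleton, forall_eq, MorseTile.mem_faceSet_of_some hT, hxs,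
      empty_subset, true_and]
    constructor
    · rintro (⟨h1, h2⟩ | ⟨ρ, h1, rfl⟩)
      · by_cases h3 : τ ⊆ T.simplex ∧ T.res ⊆ τ ∧ ¬ τ ⊆ μ
        · obtain ⟨x, hx⟩ := exists_of_ssubset (h3.1.ssubset_of_ne h2)
          exact .inr ⟨h3.1.trans (subset_insert _ _), ⟨x, hx⟩, .inr h3.2⟩
        · exact .inl ⟨h1, h3⟩
      · obtain ⟨x, hx, hx'⟩ := exists_of_ssubset h1
        refine .inr ⟨insert_subset_insert v h1.1, ⟨x, hx, ?_⟩, .inl (mem_insert_self _ _)⟩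
        grind
    · rintro (⟨h1, h2⟩ | ⟨h1, ⟨x, hx, hx'⟩, h3⟩)
      · refine .inl ⟨h1, fun h => h2 ?_⟩
        rw [h]
        exact ⟨Subset.rfl, T.res_sub, (T.morse_ssub μ hT).2⟩
      · by_cases hvτ : v ∈ τ
        · refine .inr ⟨τ.erase v, ⟨by grind, fun h => ?_⟩, (insert_erase hvτ).symm⟩
          exact hx' (mem_of_mem_erase (h hx))
        · exact .inl ⟨hK _ hfac.1 _ ((subset_insert_iff_of_notMem hvτ).1 h1),
            fun h => hx' (h ▸ hx)⟩
  · obtain ⟨x, hx, h⟩ := hsimp T' hT'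
    refine ⟨T, by simp, ?_, fun y hy => ?_⟩
    · rw [h, card_insert_of_notMem (by simp [hvσ]), card_erase_add_one hx]
    · rw [h, mem_insert] at hy
      exact hy.symm.imp mem_of_mem_erase fun e => by rwa [e]
  · have := (hms.exists_mem_faceSet_iff τ).1 ⟨T', hT', hτ⟩
    by_cases hvτ : v ∈ τ
    · exact .inr ⟨v, hvτ, hv⟩
    · exact .inl ⟨T, by simp, (MorseTile.mem_faceSet_of_some hT).2
        ⟨(subset_insert_iff_of_notMem hvτ).1 this.1, this.2.2.2.resolve_left hvτ⟩⟩
  · by_cases hρT : ρ = T.simplex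
    · subst hρT
      refine hx (insert v {x}) ((hmem _).2 (.inr ⟨{x}, ?_, rfl⟩)) (by simp)
      refine (singleton_subset_iff.2 hxρ).ssubset_of_ne fun h => ?_
      have := T.morse_card μ hT
      rw [← h, card_singleton] at this
      omega
    · exact hx ρ ((hmem ρ).2 (.inl ⟨hρ, hρT⟩)) hxρ
  · obtain ⟨x, hx, h⟩ := hsimp T' hT'
    rw [h]
    refine ⟨⟨(hmem _).2 (.inr ⟨_, erase_ssubset hx, rfl⟩), fun τ hτ hs => ?_⟩,
      fun h => hv _ (hLK h) (mem_insert_self _ _)⟩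
    have hvτ := hs (mem_insert_self v _)
    rcases (hmem τ).1 hτ with ⟨h1, -⟩ | ⟨ρ, h1, rfl⟩
    · exact absurd hvτ (hv τ h1)
    · congr 1
      have hsub : T.simplex.erase x ⊆ ρ := fun z hz =>
        (mem_insert.1 (hs (mem_insert_of_mem hz))).resolve_left fun e =>
          hvσ (e ▸ mem_of_mem_erase hz)
      refine (hsub.antisymm (subset_erase.2 ⟨h1.1, fun hxρ => h1.2 ?_⟩)).symm
      rw [← insert_erase hx]
      exact insert_subset hxρ hsub

theorem morseRefinable [Infinite V] {L : Finset (Finset V)} (hL : IsComplex L) (e : ℕ) :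
    MorseRefinable L e := by
  induction e using Nat.strong_induction_on with
  | _ e hrec =>
  intro T μ hT he K hK hLK hfac
  simp only [List.mem_singleton, forall_eq] at hfac
  have hR := T.morse_res μ hT
  have hμ := T.morse_ssub μ hT
  rcases Nat.eq_zero_or_pos e with rfl | hpos
  · have hres : T.res = μ := eq_of_subset_of_card_le hR (by omega)
    exact ⟨K, [T], .refl hK hLK (List.pairwise_singleton _ _) (by simpa using hfac.1.1),
      .cons_critical (by rw [hT, hres]) (by simp)⟩
  · obtain ⟨v, hv⟩ := Infinite.exists_notMem_finset (K.sup id)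
    have hv : ∀ τ ∈ K, v ∉ τ := fun τ hτ h => hv (mem_sup.2 ⟨τ, hτ, h⟩)
    have hlen : (μ \ T.res).toList.length = e := by
      rw [length_toList, card_sdiff_of_subset hR]
      omega
    have hbase := IsConeTiling.exists_refinable_morse hrec (hv _ hfac.1.1) hR hμ
      (T.morse_card μ hT) (T.simplex \ μ).nodup_toList (by simp) (μ \ T.res).toList T.res
      Subset.rfl hR (nodup_toList _) (by simp) hlen.le
    rw [hlen] at hbase
    obtain ⟨ms, hms, hb⟩ := IsConeTiling.exists_refinable (hv _ hfac.1.1) hR hμ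
      (zs := (μ \ T.res).toList ++ (T.simplex \ μ).toList)
      (by
        have := hμ.1
        simp only [List.mem_append, mem_toList, mem_sdiff]
        grind) T.res.toList hbase ∅ (empty_subset _)
      (nodup_toList _) (by simp)
    obtain ⟨hr, hf⟩ := refines_stellar hL hK hLK hT hfac.1 hfac.2 hv (by
      have := hμ.1
      simp only [List.mem_append, mem_toList, mem_sdiff]
      grind) hms
    obtain ⟨K', ts, hr', hb'⟩ := hb _ hr.isComplex hr.removed_subset hf
    have hnum : 1 + (2 ^ e / 2 - 1) = 2 ^ e / 2 := by
      obtain ⟨j, rfl⟩ := Nat.exists_eq_add_of_lt hpos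
      have := Nat.two_pow_pos j
      rw [Nat.zero_add, pow_succ]
      omega
    exact ⟨K', ts, hnum ▸ hr.trans hr', hb'⟩

theorem MorseTile.isComplex_removed {T : MorseTile V} {μ : Finset V} (h : T.morse = some μ) :
    IsComplex T.removed := by
  intro σ hσ τ hτ
  simp only [removed, mem_filter, mem_powerset, mem_faceSet_of_some h] at hσ ⊢
  exact ⟨hτ.trans hσ.1, fun h' => hσ.2 ⟨hσ.1, h'.2.1.trans hτ, fun hsub =>
    h'.2.2 (hτ.trans hsub)⟩⟩

/-- a non-basic regular Morse tile of order `k` with `l`-dimensional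
Morse face carries a shellable h-tiling after `2^(l-k)` stellar subdivisions at
facets, using `2^(l+1-k)` critical tiles of indices between `k` and `l+1`. -/
theorem regular_morse_tile_htiling_after_stellar_subdivisions
    {V : Type*} [DecidableEq V] [Infinite V] (n k l : ℕ)
    (T : MorseTile V) (μ : Finset V)
    (hdim : T.dim = n) (hord : T.order = k)
    (hmorse : T.morse = some μ) (hRμ : T.res ⊂ μ) (hl : μ.card = l + 1) :
    ∃ (K L : ℕ → Finset (Finset V)) (θ : ℕ → Finset V) (v : ℕ → V),
      K 0 = T.simplex.powerset ∧ L 0 = T.removed ∧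
      (∀ i < 2 ^ (l - k),
        IsFacetOf (relFaces (K i) (L i)) (θ i) ∧
        (∀ τ ∈ K i, v i ∉ τ) ∧
        K (i + 1) = stellar (K i) (θ i) (v i) ∧
        L (i + 1) = stellar (L i) (θ i) (v i)) ∧
      ∃ ts : List (MorseTile V),
        IsHShelling (relFaces (K (2 ^ (l - k))) (L (2 ^ (l - k)))) ts ∧
        totalCritical ts = 2 ^ (l + 1 - k) ∧
        (∀ T' ∈ ts, T'.IsCritical → k ≤ T'.index ∧ T'.index ≤ l + 1) ∧
        criticalCount ts k = 1 ∧ criticalCount ts (l + 1) = 1 := by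
  have hL := MorseTile.isComplex_removed hmorse
  have hcard : T.res.card < μ.card := card_lt_card hRμ
  rw [MorseTile.order] at hord
  obtain ⟨K', ts, hr, hb⟩ := morseRefinable hL (l + 1 - k) T μ hmorse (by omega)
    T.simplex.powerset (fun σ hσ τ hτ => mem_powerset.2 (hτ.trans (mem_powerset.1 hσ)))
    (filter_subset _ _) (by
      simp only [List.mem_singleton, forall_eq]
      refine ⟨⟨mem_powerset_self _, fun σ hσ h => (mem_powerset.1 hσ).antisymm h⟩, ?_⟩
      simp [MorseTile.removed, T.simplex_mem_faceSet])
  obtain ⟨F, θ, v, hF0, hFm, hF⟩ := hr.subdivides.exists_seq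
  have hnum : 2 ^ (l + 1 - k) / 2 = 2 ^ (l - k) := by
    rw [show l + 1 - k = (l - k) + 1 by omega, pow_succ, Nat.mul_div_cancel _ (by omega)]
  rw [hnum] at hFm hF
  rw [hord] at hb
  refine ⟨F, fun _ => T.removed, θ, v, hF0, rfl, hF, ts, ⟨?_, hb.isHTile⟩, hb.total,
    fun T' hT' hc => ?_, ?_, ?_⟩
  · have hS : relFaces K' T.removed = faceUnion ts := by
      ext τ
      rw [mem_faceUnion]
      simp only [relFaces, mem_filter, mem_sdiff]
      constructor
      · rintro ⟨⟨h1, h2⟩, -⟩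
        refine ((hr.mem_iff τ).1 h1).resolve_left fun h => h2 ?_
        exact mem_filter.2 ⟨h.1, h.2 T (by simp)⟩
      · rintro ⟨T', hT', hτ⟩
        refine ⟨⟨(hr.mem_iff τ).2 (.inr ⟨T', hT', hτ⟩), fun h => ?_⟩,
          MorseTile.ne_empty_of_mem_faceSet hτ⟩
        have h' := mem_filter.1 h
        rcases hr.face T' hT' τ hτ with ⟨T₀, hT₀, h0⟩ | ⟨x, hx, hf⟩
        · rw [List.mem_singleton] at hT₀
          exact h'.2 (hT₀ ▸ h0)
        · exact hf τ h'.1 hx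
    simp only [hFm, hS]
    refine hr.shellOrder.isMorseShelling (c := T.simplex.card) fun T' hT' => ?_
    obtain ⟨T₀, hT₀, h0, -⟩ := hr.simplex T' hT'
    rw [List.mem_singleton] at hT₀
    rw [h0, hT₀]
  · have := hb.index_bounds hT' hc
    omega
  · rw [hb.count]
    simp
  · rw [hb.count, if_pos (by omega), Nat.choose_self]
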